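/- arXiv:2605.17528 — 6 statements merged into one kernel-verified Lean document; each statement's English description precedes it below -/
import Mathlib

section
/- Under the ancestral sampling setup, the pushforward under Φ of the product noise measure ⊗_i μ i equals the probability mass function v ↦ ∏_{i : Fin N} μ i {u : U i | f i v u = v i}; that is, for every v : (∀ i, V i), the probability that Φ(u) = v when each coordinate u i is drawn independently from μ i is exactly ∏_i μ i {u | f i v u = v i}. -/
open MeasureTheory

/-- **Ancestral sampling pushforward formula.**
Setup: for each `i : Fin N`, `V i` and `U i` are finite nonempty (discrete
measurable) types, `μ i : PMF (U i)` is the noise distribution, `pa i` is the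
parent set of `i` with every `j ∈ pa i` satisfying `j < i` (topological
order), and the structural function `f i` depends only on the parent
coordinates.  `Φ` is the ancestral-sampling map, characterized by
`Φ u i = f i (Φ u) (u i)`.  Then the pushforward under `Φ` of the product
noise measure `⊗ᵢ μ i` equals the pmf
`v ↦ ∏ i, μ i {u | f i v u = v i}`: for every `v`,
`(Measure.map Φ (Measure.pi (μ ·).toMeasure)) {v} = ∏ i, (μ i).toMeasure {u | f i v u = v i}`. -/
theorem ancestral_sampling_pushforward
    {N : ℕ} {V U : Fin N → Type*}
    [∀ i, Fintype (V i)] [∀ i, Nonempty (V i)]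
    [∀ i, Fintype (U i)] [∀ i, Nonempty (U i)]
    [∀ i, MeasurableSpace (U i)] [∀ i, DiscreteMeasurableSpace (U i)]
    [∀ i, MeasurableSpace (V i)] [∀ i, DiscreteMeasurableSpace (V i)]
    (μ : ∀ i, PMF (U i))
    (pa : Fin N → Finset (Fin N))
    (hpa : ∀ i, ∀ j ∈ pa i, j < i)
    (f : ∀ i : Fin N, (∀ j, V j) → U i → V i)
    (hf : ∀ i (v w : ∀ j, V j) (n : U i),
      (∀ j ∈ pa i, v j = w j) → f i v n = f i w n)
    (Φ : (∀ i, U i) → ∀ i, V i)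
    (hΦ : ∀ u i, Φ u i = f i (Φ u) (u i)) :
    ∀ v : ∀ i, V i,
      Measure.map Φ (Measure.pi fun i => (μ i).toMeasure) {v} =
        ∏ i, (μ i).toMeasure {u : U i | f i v u = v i} := by
  intro v
  rw [Measure.map_apply (Measurable.of_discrete) (MeasurableSet.singleton v)]
  have h : Φ ⁻¹' {v} = Set.univ.pi fun i => {n : U i | f i v n = v i} := by
    ext u
    simp only [Set.mem_preimage, Set.mem_singleton_iff, Set.mem_univ_pi, Set.mem_setOf_eq]
    constructor
    · intro h i
      have := hΦ u i
      rw [h] at this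
      exact this.symm
    · intro h
      have key : ∀ n : ℕ, ∀ i : Fin N, i.val = n → Φ u i = v i := by
        intro n
        induction n using Nat.strong_induction_on with
        | _ n ih =>
          intro i hi
          rw [hΦ u i, ← h i]
          apply hf
          intro j hj
          have hlt : j.val < i.val := hpa i j hj
          exact ih j.val (by omega) j rfl
      funext i
      exact key i.val i rfl
  rw [h, Measure.pi_pi]
end

section
/- Under the ancestral sampling setup, the construction satisfies the local Markov property: for every i : Fin N, letting S := {j : Fin N | j ≠ i, j ∉ pa i, and j is not a descendant of i}, the random variable u ↦ Φ u i is conditionally independent of the random variable u ↦ (Φ u restricted to S), given the random variable u ↦ (Φ u restricted to pa i), with respect to the product noise measure ⊗_i μ i. -/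
open MeasureTheory ProbabilityTheory

lemma asm_aux1 {Ω A B C : Type*} {mΩ : MeasurableSpace Ω} (μ : Measure Ω) [IsProbabilityMeasure μ]
    [mA : MeasurableSpace A] [MeasurableSpace B] [MeasurableSpace C]
    (P : Ω → A) (Y : Ω → B) (W : Ω → C) (hP : Measurable P) (hY : Measurable Y) (hW : Measurable W)
    (h : IndepFun W (fun ω => (P ω, Y ω)) μ) (c : Set C) (hc : MeasurableSet c)
    (t : Set B) (ht : MeasurableSet t) :
    (fun ω => μ.real (W ⁻¹' c) * (μ⟦Y ⁻¹' t | mA.comap P⟧) ω) =ᵐ[μ]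
      μ⟦W ⁻¹' c ∩ Y ⁻¹' t | mA.comap P⟧ := by
  have hm : mA.comap P ≤ mΩ := hP.comap_le
  have hB : MeasurableSet (Y ⁻¹' t) := hY ht
  have hC : MeasurableSet (W ⁻¹' c) := hW hc
  refine ae_eq_condExp_of_forall_setIntegral_eq hm
    ((integrable_const (1 : ℝ)).indicator (hC.inter hB)) ?_ ?_ ?_
  · intro s _ _
    exact (integrable_condExp.const_mul _).integrableOn
  · rintro s ⟨a, ha, rfl⟩ _
    rw [integral_const_mul, setIntegral_condExp hm ((integrable_const (1 : ℝ)).indicator hB)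
      ⟨a, ha, rfl⟩, setIntegral_indicator hB, setIntegral_indicator (hC.inter hB)]
    simp only [setIntegral_const, smul_eq_mul, mul_one]
    have := h.measure_inter_preimage_eq_mul c (a ×ˢ t) hc (ha.prod ht)
    simp only [Measure.real]
    rw [← ENNReal.toReal_mul]
    congr 1
    have e1 : (fun ω => (P ω, Y ω)) ⁻¹' (a ×ˢ t) = P ⁻¹' a ∩ Y ⁻¹' t := rfl
    rw [e1] at this
    rw [← this]
    congr 1
    ext; simp; tauto
  · exact (stronglyMeasurable_condExp.const_mul _).aestronglyMeasurable

lemma asm_aux2 {Ω A B C D : Type*} {mΩ : MeasurableSpace Ω} (μ : Measure Ω) [IsProbabilityMeasure μ]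
    [Countable A] [mA : MeasurableSpace A] [DiscreteMeasurableSpace A]
    [MeasurableSpace B] [MeasurableSpace C] [DiscreteMeasurableSpace C]
    (P : Ω → A) (Y : Ω → B) (W : Ω → C) (hP : Measurable P) (hY : Measurable Y) (hW : Measurable W)
    (X : Ω → D) [MeasurableSpace D] (hX : Measurable X)
    (g : A → C → D) (hg : ∀ ω, X ω = g (P ω) (W ω))
    (h : IndepFun W (fun ω => (P ω, Y ω)) μ) (s : Set D) (hs : MeasurableSet s)
    (t : Set B) (ht : MeasurableSet t) :
    ∀ᵐ ω ∂μ, (μ⟦X ⁻¹' s ∩ Y ⁻¹' t | mA.comap P⟧) ω =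
      μ.real (W ⁻¹' (g (P ω) ⁻¹' s)) * (μ⟦Y ⁻¹' t | mA.comap P⟧) ω := by
  have hB : MeasurableSet (Y ⁻¹' t) := hY ht
  have key : ∀ p : A, ∀ᵐ ω ∂μ, P ω = p → (μ⟦X ⁻¹' s ∩ Y ⁻¹' t | mA.comap P⟧) ω =
      μ.real (W ⁻¹' (g p ⁻¹' s)) * (μ⟦Y ⁻¹' t | mA.comap P⟧) ω := by
    intro p
    have hD : MeasurableSet[mA.comap P] (P ⁻¹' {p}) := ⟨{p}, .of_discrete, rfl⟩
    have hC : MeasurableSet (W ⁻¹' (g p ⁻¹' s)) := hW .of_discrete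
    have h1 := condExp_indicator (μ := μ) (m := mA.comap P)
      ((integrable_const (1 : ℝ)).indicator ((hX hs).inter hB)) hD
    have h2 := condExp_indicator (μ := μ) (m := mA.comap P)
      ((integrable_const (1 : ℝ)).indicator (hC.inter hB)) hD
    have e : (P ⁻¹' {p}).indicator ((X ⁻¹' s ∩ Y ⁻¹' t).indicator fun _ => (1 : ℝ)) =
        (P ⁻¹' {p}).indicator ((W ⁻¹' (g p ⁻¹' s) ∩ Y ⁻¹' t).indicator fun _ => (1 : ℝ)) := by
      rw [Set.indicator_indicator, Set.indicator_indicator]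
      congr 1
      ext ω
      simp only [Set.mem_inter_iff, Set.mem_preimage, Set.mem_singleton_iff, hg ω]
      constructor <;> (rintro ⟨rfl, hh⟩; exact ⟨rfl, hh⟩)
    rw [e] at h1
    filter_upwards [h1, h2, asm_aux1 μ P Y W hP hY hW h _ (.of_discrete : MeasurableSet (g p ⁻¹' s))
      t ht] with ω w1 w2 w3 hp
    rw [w3]
    rw [w1] at w2
    rwa [Set.indicator_of_mem (by simpa using hp), Set.indicator_of_mem (by simpa using hp)] at w2
  filter_upwards [ae_all_iff.2 key] with ω hω
  exact hω _ rfl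

lemma asm_aux3 {Ω A B C D : Type*} {mΩ : MeasurableSpace Ω} [StandardBorelSpace Ω]
    (μ : Measure Ω) [IsProbabilityMeasure μ]
    [Countable A] [mA : MeasurableSpace A] [DiscreteMeasurableSpace A]
    [MeasurableSpace B] [MeasurableSpace C] [DiscreteMeasurableSpace C]
    (P : Ω → A) (Y : Ω → B) (W : Ω → C) (hP : Measurable P) (hY : Measurable Y) (hW : Measurable W)
    (X : Ω → D) [MeasurableSpace D] (hX : Measurable X)
    (g : A → C → D) (hg : ∀ ω, X ω = g (P ω) (W ω))
    (h : IndepFun W (fun ω => (P ω, Y ω)) μ) (hm : mA.comap P ≤ mΩ) :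
    CondIndepFun (mA.comap P) hm X Y μ := by
  rw [condIndepFun_iff_condExp_inter_preimage_eq_mul hX hY]
  intro s t hs ht
  have h1 := asm_aux2 μ P Y W hP hY hW X hX g hg h s hs t ht
  have h2 := asm_aux2 μ P Y W hP hY hW X hX g hg h s hs Set.univ .univ
  have h3 : μ⟦Y ⁻¹' (Set.univ : Set B) | mA.comap P⟧ = fun _ => (1 : ℝ) := by
    simp only [Set.preimage_univ, Set.indicator_univ]
    exact condExp_const hm (1 : ℝ)
  rw [h3] at h2
  simp only [Set.preimage_univ, Set.inter_univ, mul_one] at h2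
  filter_upwards [h1, h2] with ω w1 w2
  rw [w1, w2]

/-- **Local Markov property of ancestral sampling.**
Setup: for each `i : Fin N`, `V i` and `U i` are finite nonempty (discrete
measurable) types, `μ i : PMF (U i)` is the noise distribution, `pa i` is the
parent set of `i` with every `j ∈ pa i` satisfying `j < i` (topological
order), the structural function `f i` depends only on the parent coordinates,
and `Φ` is the ancestral-sampling map, characterized by
`Φ u i = f i (Φ u) (u i)`.  `j` is a descendant of `i` iff
`Relation.TransGen (fun a b => a ∈ pa b) i j` (a directed path from `i` to
`j`).  Let `S` be the set of non-parent non-descendants of `i` (excluding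
`i`).  Then, with respect to the product noise measure `⊗ᵢ μ i`, the random
variable `u ↦ Φ u i` is conditionally independent of `u ↦ (Φ u)|_S` given
`u ↦ (Φ u)|_{pa i}`. -/
theorem ancestral_sampling_local_markov
    {N : ℕ} {V U : Fin N → Type*}
    [∀ i, Fintype (V i)] [∀ i, Nonempty (V i)]
    [∀ i, Fintype (U i)] [∀ i, Nonempty (U i)]
    [∀ i, MeasurableSpace (U i)] [∀ i, DiscreteMeasurableSpace (U i)]
    [∀ i, MeasurableSpace (V i)] [∀ i, DiscreteMeasurableSpace (V i)]
    (μ : ∀ i, PMF (U i))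
    (pa : Fin N → Finset (Fin N))
    (hpa : ∀ i, ∀ j ∈ pa i, j < i)
    (f : ∀ i : Fin N, (∀ j, V j) → U i → V i)
    (hf : ∀ i (v w : ∀ j, V j) (n : U i),
      (∀ j ∈ pa i, v j = w j) → f i v n = f i w n)
    (Φ : (∀ i, U i) → ∀ i, V i)
    (hΦ : ∀ u i, Φ u i = f i (Φ u) (u i))
    (i : Fin N)
    (S : Set (Fin N))
    (hS : S = {j | j ≠ i ∧ j ∉ pa i ∧
      ¬ Relation.TransGen (fun a b => a ∈ pa b) i j}) :
    CondIndepFun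
      (MeasurableSpace.comap (fun u (j : pa i) => Φ u j.1) inferInstance)
      (fun _ _ => MeasurableSet.of_discrete)
      (fun u => Φ u i)
      (fun u (j : S) => Φ u j.1)
      (Measure.pi fun i => (μ i).toMeasure) := by
  classical
  have hlt : ∀ j, Relation.TransGen (fun a b => a ∈ pa b) i j → i < j := by
    intro j hj
    induction hj with
    | single h => exact hpa _ _ h
    | tail _ h ih => exact ih.trans (hpa _ _ h)
  have hdep : ∀ u u' : (∀ i, U i), (∀ j, j ≠ i → u j = u' j) → ∀ j : Fin N, j ≠ i →
      ¬ Relation.TransGen (fun a b => a ∈ pa b) i j → Φ u j = Φ u' j := by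
    intro u u' huu j
    induction j using WellFoundedLT.induction with
    | ind j ih =>
      intro hj hnd
      rw [hΦ u j, hΦ u' j, huu j hj]
      refine hf _ _ _ _ fun k hk => ih k (hpa _ _ hk) ?_ ?_
      · rintro rfl
        exact hnd (.single hk)
      · exact fun hd => hnd (hd.tail hk)
  have hpar : ∀ j ∈ pa i, j ≠ i ∧ ¬ Relation.TransGen (fun a b => a ∈ pa b) i j := fun j hj =>
    ⟨(hpa _ _ hj).ne, fun hd => lt_asymm (hlt j hd) (hpa _ _ hj)⟩
  have hind := (iIndepFun_pi (μ := fun i => (μ i).toMeasure) (X := fun _ => id)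
    (fun _ => aemeasurable_id)).indepFun_finset {i} {i}ᶜ disjoint_compl_right
    (fun j => measurable_pi_apply j)
  let ext : (∀ j : (({i}ᶜ : Finset (Fin N))), U j) → ∀ j, U j := fun z j =>
    if h : j ∈ ({i}ᶜ : Finset (Fin N)) then z ⟨j, h⟩ else Classical.arbitrary _
  have hext : ∀ (u : ∀ j, U j) (j : Fin N), j ≠ i →
      ext (fun k => u k) j = u j := by
    intro u j hj
    simp [ext, hj]
  have hφ : Measurable (fun z : (∀ j : (({i} : Finset (Fin N))), U j) =>
      (z ⟨i, Finset.mem_singleton_self i⟩ : U i)) := .of_discrete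
  have hind2 := hind.comp
    (ψ := fun z => ((fun (j : pa i) => Φ (ext z) j.1), (fun (j : S) => Φ (ext z) j.1)))
    hφ .of_discrete
  refine asm_aux3 _ _ _ (fun u => u i) .of_discrete .of_discrete .of_discrete _ .of_discrete
    (fun p n => f i (fun j => if h : j ∈ pa i then p ⟨j, h⟩ else Classical.arbitrary _) n) ?_ ?_ _
  · intro u
    rw [hΦ]
    exact hf _ _ _ _ fun j hj => by simp [hj]
  · refine hind2.congr (Filter.EventuallyEq.of_eq rfl) (Filter.EventuallyEq.of_eq ?_)
    symm
    funext u
    refine Prod.ext ?_ ?_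
    · funext j
      exact (hdep _ _ (hext u) j.1 (hpar _ j.2).1 (hpar _ j.2).2).symm
    · funext j
      have hj := j.2
      simp only [hS, Set.mem_setOf_eq] at hj
      exact (hdep _ _ (hext u) j.1 hj.1 hj.2.2).symm
end

section
/- Under the iterative-realizability setup, suppose additionally that there is a constant p̲ with 0 < p̲ ≤ 1 such that p 1 v ≥ p̲ for all v, and let P : V → ℝ be a full-support probability mass function (P v > 0 for all v, ∑_v P v = 1). For each K ≥ 1 let Z_K := ∑_v P v * φ_K v and Q_K v := P v * φ_K v / Z_K (note Z_K > 0 since φ_K v ≥ 1 − (1 − p̲)^K > 0). Then the Kullback–Leibler divergence D_KL(P ∥ Q_K) := ∑_v P v * log (P v / Q_K v) tends to 0 as K → ∞. -/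
/-- **KL divergence to the accepted distribution vanishes as `K → ∞`.**
Iterative-realizability setup: `V` finite nonempty, `p : ℕ → V → ℝ` with
`0 ≤ p k v ≤ 1` for `k ≥ 1`, monotone feedback `p k v ≤ p (k+1) v` for
`k ≥ 1`, and `φ K v = 1 - ∏_{k=1}^{K} (1 - p k v)` for `K ≥ 1`.
Assume `0 < q ≤ 1` with `p 1 v ≥ q` for all `v`, and let `P` be a
full-support probability mass function on `V`.  With
`Z K = ∑ v, P v * φ K v` and `Q K v = P v * φ K v / Z K`, the
Kullback–Leibler divergence `D_KL(P ∥ Q K) = ∑ v, P v * log (P v / Q K v)`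
tends to `0` as `K → ∞` (natural logarithm). -/
theorem kl_divergence_tendsto_zero
    {V : Type*} [Fintype V] [Nonempty V]
    (p : ℕ → V → ℝ)
    (hp0 : ∀ k, 1 ≤ k → ∀ v, 0 ≤ p k v) (hp1 : ∀ k, 1 ≤ k → ∀ v, p k v ≤ 1)
    (hmono : ∀ k, 1 ≤ k → ∀ v, p k v ≤ p (k + 1) v)
    (φ : ℕ → V → ℝ)
    (hφ : ∀ K, 1 ≤ K → ∀ v, φ K v = 1 - ∏ k ∈ Finset.Icc 1 K, (1 - p k v))
    (q : ℝ) (hq0 : 0 < q) (hq1 : q ≤ 1)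
    (hlb : ∀ v, q ≤ p 1 v)
    (P : V → ℝ) (hPpos : ∀ v, 0 < P v) (hP1 : ∑ v, P v = 1)
    (Z : ℕ → ℝ) (hZ : ∀ K, Z K = ∑ v, P v * φ K v)
    (Q : ℕ → V → ℝ) (hQ : ∀ K v, Q K v = P v * φ K v / Z K) :
    Filter.Tendsto (fun K => ∑ v, P v * Real.log (P v / Q K v))
      Filter.atTop (nhds 0) := by
  have hge : ∀ v k, 1 ≤ k → q ≤ p k v := by
    intro v k hk
    induction k, hk using Nat.le_induction with
    | base => exact hlb v
    | succ n hn ih => exact ih.trans (hmono n hn v)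
  have hprod : ∀ v, Filter.Tendsto (fun K => ∏ k ∈ Finset.Icc 1 K, (1 - p k v))
      Filter.atTop (nhds 0) := by
    intro v
    refine squeeze_zero (g := fun K : ℕ => (1 - q) ^ K) ?_ ?_
      (tendsto_pow_atTop_nhds_zero_of_lt_one (by linarith) (by linarith))
    · intro K
      refine Finset.prod_nonneg fun k hk => ?_
      have := hp1 k (Finset.mem_Icc.1 hk).1 v
      linarith
    · intro K
      calc ∏ k ∈ Finset.Icc 1 K, (1 - p k v) ≤ ∏ k ∈ Finset.Icc 1 K, (1 - q) := by
            refine Finset.prod_le_prod (fun k hk => ?_) (fun k hk => ?_)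
            · have := hp1 k (Finset.mem_Icc.1 hk).1 v
              linarith
            · have := hge v k (Finset.mem_Icc.1 hk).1
              linarith
        _ = (1 - q) ^ K := by simp
  have hφt : ∀ v, Filter.Tendsto (fun K => φ K v) Filter.atTop (nhds 1) := by
    intro v
    have h := (hprod v).const_sub 1
    rw [sub_zero] at h
    refine h.congr' ?_
    filter_upwards [Filter.eventually_ge_atTop 1] with K hK
    exact (hφ K hK v).symm
  have hZt : Filter.Tendsto Z Filter.atTop (nhds 1) := by
    have h : Filter.Tendsto (fun K => ∑ v, P v * φ K v) Filter.atTop (nhds (∑ v, P v * 1)) :=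
      tendsto_finsetSum _ fun v _ => (hφt v).const_mul (P v)
    simp only [mul_one, hP1] at h
    exact h.congr fun K => (hZ K).symm
  have hQt : ∀ v, Filter.Tendsto (fun K => Q K v) Filter.atTop (nhds (P v)) := by
    intro v
    have h := ((hφt v).const_mul (P v)).div hZt one_ne_zero
    simp only [mul_one, div_one] at h
    exact h.congr fun K => (hQ K v).symm
  have hmain : Filter.Tendsto (fun K => ∑ v, P v * Real.log (P v / Q K v)) Filter.atTop
      (nhds (∑ v, P v * Real.log (P v / P v))) := by
    refine tendsto_finsetSum _ fun v _ => Filter.Tendsto.const_mul _ ?_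
    have hne := (hPpos v).ne'
    exact (tendsto_const_nhds.div (hQt v) hne).log (div_ne_zero hne hne)
  have h0 : ∑ v, P v * Real.log (P v / P v) = 0 :=
    Finset.sum_eq_zero fun v _ => by rw [div_self (hPpos v).ne', Real.log_one, mul_zero]
  rwa [h0] at hmain
end

section
/- (Fano's inequality, per-variable conditional entropy bound) Under the discrete entropy setup, let A be a finite type with at least 2 elements and let X X̂ : Ω → A be random variables. Let e := P({ω | X̂ ω ≠ X ω}) be the error probability. Then H(X ∣ X̂) ≤ H_b(e) + e * log (|A| − 1). -/
open scoped BigOperators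

/-- The probability of an event `s` under a probability mass function `P` on a
finite type `Ω`. -/
noncomputable def probOf {Ω : Type*} [Fintype Ω] (P : Ω → ℝ) (s : Set Ω) : ℝ :=
  ∑ ω, s.indicator P ω

/-- Shannon conditional entropy `H(Y ∣ Z)` (natural logarithm) of finite-valued
random variables on a finite probability space:
`H(Y ∣ Z) = -∑_{b,c} P(Y = b ∧ Z = c) * log (P(Y = b ∧ Z = c) / P(Z = c))`.
Terms with `P(Y = b ∧ Z = c) = 0` contribute `0` (as `0 * log _ = 0`), which
also covers the pairs with `P(Z = c) = 0`. -/
noncomputable def condEnt {Ω B C : Type*} [Fintype Ω] [Fintype B] [Fintype C]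
    (P : Ω → ℝ) (Y : Ω → B) (Z : Ω → C) : ℝ :=
  -∑ b : B, ∑ c : C,
      probOf P {ω | Y ω = b ∧ Z ω = c} *
        Real.log (probOf P {ω | Y ω = b ∧ Z ω = c} / probOf P {ω | Z ω = c})

/-- The binary entropy function `H_b(t) = -t log t - (1-t) log (1-t)`
(natural logarithm), with `H_b(0) = H_b(1) = 0` via the convention
`log 0 = 0`. -/
noncomputable def binEnt (t : ℝ) : ℝ :=
  -t * Real.log t - (1 - t) * Real.log (1 - t)

theorem fano_joint_sum {Ω A : Type*} [Fintype Ω] [Fintype A]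
    (P : Ω → ℝ) (X Z : Ω → A) (f : A → A → ℝ) :
    ∑ b : A, ∑ c : A, probOf P {ω | X ω = b ∧ Z ω = c} * f b c
      = ∑ ω, P ω * f (X ω) (Z ω) := by
  classical
  unfold probOf
  simp only [Finset.sum_mul]
  have h1 : ∀ b : A, ∑ c : A, ∑ ω, ({ω | X ω = b ∧ Z ω = c} : Set Ω).indicator P ω * f b c
      = ∑ ω, ∑ c : A, ({ω | X ω = b ∧ Z ω = c} : Set Ω).indicator P ω * f b c :=
    fun b => Finset.sum_comm
  simp only [h1]
  rw [Finset.sum_comm]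
  refine Finset.sum_congr rfl fun ω _ => ?_
  rw [Finset.sum_eq_single (X ω), Finset.sum_eq_single (Z ω)]
  · simp [Set.indicator]
  · intro c _ hc
    simp [Set.indicator, hc.symm]
  · simp
  · intro b _ hb
    simp [Set.indicator, hb.symm]
  · simp

theorem fano_marg {Ω A : Type*} [Fintype Ω] [Fintype A]
    (P : Ω → ℝ) (X Z : Ω → A) (c : A) :
    probOf P {ω | Z ω = c} = ∑ b : A, probOf P {ω | X ω = b ∧ Z ω = c} := by
  classical
  unfold probOf
  rw [Finset.sum_comm]
  refine Finset.sum_congr rfl fun ω _ => ?_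
  rw [Finset.sum_eq_single (X ω)]
  · simp [Set.indicator]
  · intro b _ hb
    simp [Set.indicator, hb.symm]
  · simp

theorem fano_gibbs (p r q : ℝ) (hp : 0 ≤ p) (hpr : p ≤ r) (hq : 0 ≤ q) (hpq : 0 < p → 0 < q) :
    -(p * Real.log (p / r)) ≤ -(p * Real.log q) + (r * q - p) := by
  rcases hp.eq_or_lt with h | h
  · subst h
    simpa using mul_nonneg hpr hq
  · have hq' := hpq h
    have hr : 0 < r := h.trans_le hpr
    have h1 := Real.log_le_sub_one_of_pos (show 0 < r * q / p by positivity)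
    rw [Real.log_div (by positivity) h.ne', Real.log_mul hr.ne' hq'.ne'] at h1
    rw [Real.log_div h.ne' hr.ne']
    have h2 := mul_le_mul_of_nonneg_left h1 hp
    have h3 : p * (r * q / p - 1) = r * q - p := by field_simp
    rw [h3] at h2
    linarith

/-- **Fano's inequality (per-variable conditional entropy bound).**
Let `Ω` be a finite nonempty probability space with pmf `P`, let `A` be a
finite type with at least `2` elements, and let `X X̂ : Ω → A`.  With the
error probability `e = P(X̂ ≠ X)`, we have
`H(X ∣ X̂) ≤ H_b(e) + e * log (|A| - 1)`. -/
theorem fano_inequality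
    {Ω A : Type*} [Fintype Ω] [Nonempty Ω] [Fintype A]
    (hA : 2 ≤ Fintype.card A)
    (P : Ω → ℝ) (hP0 : ∀ ω, 0 ≤ P ω) (hP1 : ∑ ω, P ω = 1)
    (X Xhat : Ω → A)
    (e : ℝ) (he : e = probOf P {ω | Xhat ω ≠ X ω}) :
    condEnt P X Xhat ≤ binEnt e + e * Real.log ((Fintype.card A : ℝ) - 1) := by
  classical
  set n : ℝ := (Fintype.card A : ℝ) with hn
  have hn2 : (2 : ℝ) ≤ n := by rw [hn]; exact_mod_cast hA
  have hn1 : 0 < n - 1 := by linarith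
  set p : A → A → ℝ := fun b c => probOf P {ω | X ω = b ∧ Xhat ω = c} with hpdef
  set r : A → ℝ := fun c => probOf P {ω | Xhat ω = c} with hrdef
  have hp0 : ∀ b c, 0 ≤ p b c := fun b c =>
    Finset.sum_nonneg fun ω _ => Set.indicator_nonneg (fun ω _ => hP0 ω) ω
  have hr : ∀ c, r c = ∑ b, p b c := fano_marg P X Xhat
  have hpr : ∀ b c, p b c ≤ r c := fun b c => by
    rw [hr]
    exact Finset.single_le_sum (f := fun b => p b c) (fun b _ => hp0 b c) (Finset.mem_univ b)
  have hJ : ∀ f : A → A → ℝ, ∑ b, ∑ c, p b c * f b c = ∑ ω, P ω * f (X ω) (Xhat ω) :=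
    fano_joint_sum P X Xhat
  have hsum1 : ∑ b, ∑ c, p b c = 1 := by
    have := hJ (fun _ _ => 1)
    simpa [hP1] using this
  have hrsum : ∑ c, r c = 1 := by
    simp only [hr]
    rw [Finset.sum_comm]; exact hsum1
  let d : A → A → ℝ := fun b c => if b = c then 0 else 1
  have hd0 : ∀ b c, 0 ≤ d b c := fun b c => by
    show (0 : ℝ) ≤ if b = c then 0 else 1
    split_ifs <;> norm_num
  have hd1 : ∀ b c, d b c ≤ 1 := fun b c => by
    show (if b = c then (0 : ℝ) else 1) ≤ 1
    split_ifs <;> norm_num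
  have hesum : ∑ b, ∑ c, p b c * d b c = e := by
    rw [hJ, he]
    unfold probOf
    refine Finset.sum_congr rfl fun ω _ => ?_
    by_cases h : X ω = Xhat ω
    · simp [d, Set.indicator, h]
    · simp [d, Set.indicator, h, Ne.symm h]
  have hle : ∀ (f : A → A → ℝ), (∀ b c, 0 ≤ f b c) → ∀ b c, f b c ≤ ∑ b, ∑ c, f b c := by
    intro f hf b c
    exact (Finset.single_le_sum (f := fun c => f b c) (fun c _ => hf b c) (Finset.mem_univ c)).trans
      (Finset.single_le_sum (f := fun b => ∑ c, f b c)
        (fun b _ => Finset.sum_nonneg fun c _ => hf b c) (Finset.mem_univ b))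
  have he1sum : ∑ b, ∑ c, p b c * (1 - d b c) = 1 - e := by
    simp only [mul_sub, mul_one, Finset.sum_sub_distrib, hsum1, hesum]
  have he0 : 0 ≤ e := by
    rw [← hesum]
    exact Finset.sum_nonneg fun b _ => Finset.sum_nonneg fun c _ => mul_nonneg (hp0 b c) (hd0 b c)
  have he1 : 0 ≤ 1 - e := by
    rw [← he1sum]
    exact Finset.sum_nonneg fun b _ => Finset.sum_nonneg fun c _ =>
      mul_nonneg (hp0 b c) (sub_nonneg.2 (hd1 b c))
  let q : A → A → ℝ := fun b c => if b = c then 1 - e else e / (n - 1)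
  have hq0 : ∀ b c, 0 ≤ q b c := fun b c => by
    show (0 : ℝ) ≤ if b = c then 1 - e else e / (n - 1)
    split_ifs
    · exact he1
    · positivity
  have hpq : ∀ b c, 0 < p b c → 0 < q b c := by
    intro b c h
    by_cases hbc : b = c
    · have h1 := hle (fun b c => p b c * (1 - d b c))
        (fun b c => mul_nonneg (hp0 b c) (sub_nonneg.2 (hd1 b c))) b c
      simp only [he1sum] at h1
      simp only [d, q, hbc, if_true] at h1 ⊢
      rw [hbc] at h
      linarith
    · have h1 := hle (fun b c => p b c * d b c) (fun b c => mul_nonneg (hp0 b c) (hd0 b c)) b c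
      simp only [hesum] at h1
      simp only [d, q, hbc, if_false] at h1 ⊢
      have : 0 < e := by linarith
      positivity
  have hqsum : ∀ c, ∑ b, q b c = 1 := by
    intro c
    have h1 : ∀ b, q b c = e / (n - 1) + if b = c then (1 - e - e / (n - 1)) else 0 := by
      intro b
      simp only [q]
      split_ifs <;> ring
    simp only [h1, Finset.sum_add_distrib, Finset.sum_const, Finset.card_univ, nsmul_eq_mul,
      Finset.sum_ite_eq', Finset.mem_univ, if_true, ← hn]
    field_simp
    ring
  have hrq : ∑ b, ∑ c, r c * q b c = 1 := by
    rw [Finset.sum_comm]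
    simp only [← Finset.mul_sum, hqsum, mul_one, hrsum]
  have hlog : ∑ b, ∑ c, p b c * Real.log (q b c)
      = (1 - e) * Real.log (1 - e) + e * Real.log (e / (n - 1)) := by
    have h1 : ∀ b c, p b c * Real.log (q b c) = p b c * (1 - d b c) * Real.log (1 - e)
        + p b c * d b c * Real.log (e / (n - 1)) := by
      intro b c
      simp only [d, q]
      split_ifs <;> ring
    simp only [h1, Finset.sum_add_distrib, ← Finset.sum_mul, he1sum, hesum]
  have helog : e * Real.log (e / (n - 1)) = e * Real.log e - e * Real.log (n - 1) := by
    rcases he0.eq_or_lt with h | h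
    · simp [← h]
    · rw [Real.log_div h.ne' hn1.ne']; ring
  have hmain : ∑ b, ∑ c, -(p b c * Real.log (p b c / r c))
      ≤ ∑ b, ∑ c, (-(p b c * Real.log (q b c)) + (r c * q b c - p b c)) :=
    Finset.sum_le_sum fun b _ => Finset.sum_le_sum fun c _ =>
      fano_gibbs _ _ _ (hp0 b c) (hpr b c) (hq0 b c) (hpq b c)
  simp only [Finset.sum_add_distrib, Finset.sum_sub_distrib, Finset.sum_neg_distrib, hlog, hrq,
    hsum1, helog] at hmain
  have hc : condEnt P X Xhat = -∑ b, ∑ c, p b c * Real.log (p b c / r c) := rfl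
  rw [hc]
  unfold binEnt
  linarith
end

section
/- (Unique solvability of an acyclic structural causal model at fixed noise) Under the acyclic SCM setup with structural functions f and fixed noise vector u, there exists a unique v : (∀ i, V i) such that v i = f i v (u i) for every i : Fin N. -/
/-- **Unique solvability of an acyclic structural causal model at fixed
noise.**  Let `pa : Fin N → Fin N → Prop` be an acyclic parenthood relation
(`pa i j` means `j` is a parent of `i`; acyclicity: the transitive closure of
the child relation is irreflexive).  For each `i` let `V i` be nonempty, let
`u i : U i` be a fixed noise value, and let the structural function
`f i : (∀ j, V j) → U i → V i` depend only on the parent coordinates.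
Then there exists a unique `v` with `v i = f i v (u i)` for every `i`. -/
theorem scm_unique_solution
    {N : ℕ} {V U : Fin N → Type*} [∀ i, Nonempty (V i)]
    (pa : Fin N → Fin N → Prop)
    (hacyc : Irreflexive (Relation.TransGen fun a b => pa b a))
    (u : ∀ i, U i)
    (f : ∀ i, (∀ j, V j) → U i → V i)
    (hf : ∀ i (v w : ∀ j, V j) (n : U i),
      (∀ j, pa i j → v j = w j) → f i v n = f i w n) :
    ∃! v : ∀ i, V i, ∀ i, v i = f i v (u i) := by
  classical
  have wf : WellFounded (fun a b : Fin N => pa b a) := by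
    haveI : Std.Irrefl (Relation.TransGen fun a b : Fin N => pa b a) := ⟨fun a => hacyc a⟩
    have h := Finite.wellFounded_of_trans_of_irrefl (Relation.TransGen fun a b : Fin N => pa b a)
    exact ⟨fun a => Subrelation.accessible (fun {x y} (hab : pa y x) => Relation.TransGen.single (r := fun a b : Fin N => pa b a) hab) (h.apply a)⟩
  let F : ∀ i, (∀ j, pa i j → V j) → V i := fun i g =>
    f i (fun j => if h : pa i j then g j h else Classical.arbitrary (V j)) (u i)
  refine ⟨fun i => wf.fix F i, ?_, ?_⟩
  · intro i
    show wf.fix F i = _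
    rw [wf.fix_eq]
    apply hf
    intro j hj
    simp [hj]
  · intro w hw
    funext i
    induction i using wf.induction with
    | _ i ih =>
      rw [hw i, wf.fix_eq]
      apply hf
      intro j hj
      simpa [hj] using ih j hj
end

section
/- (Non-descendant invariance under intervention) Under the acyclic SCM setup with structural functions f and fixed noise vector u, fix X : Fin N and x : V X, and define the mutilated structural functions g by g X v n := x (constant, depending on no coordinates) and g i := f i for i ≠ X. Let v be the unique solution of the original system (v i = f i v (u i) for all i) and v' the unique solution of the mutilated system (v' i = g i v' (u i) for all i). Then for every j : Fin N with j ≠ X that is not a descendant of X — i.e., there is no chain X = k₀, k₁, …, k_m = j with m ≥ 1 and pa k_{t+1} k_t for each t (no directed path from X to j) — one has v' j = v j. -/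
/-- **Non-descendant invariance under intervention.**
Acyclic SCM setup: `pa i j` means `j` is a parent of `i`, the transitive
closure of the child relation `fun a b => pa b a` is irreflexive, and each
structural function `f i` depends only on the parent coordinates.  Fix an
intervention target `X` and value `x : V X`, and let `g` be the mutilated
system: `g X v n = x` (depending on no coordinates) and `g i = f i` for
`i ≠ X`.  If `v` solves the original system (`v i = f i v (u i)` for all `i`)
and `v'` solves the mutilated system (`v' i = g i v' (u i)` for all `i`),
then for every `j ≠ X` that is not a descendant of `X` (i.e., there is no
directed path from `X` to `j` along the child relation), `v' j = v j`. -/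
theorem nondescendant_invariance_under_intervention
    {N : ℕ} {V U : Fin N → Type*} [∀ i, Nonempty (V i)]
    (pa : Fin N → Fin N → Prop)
    (hacyc : Irreflexive (Relation.TransGen fun a b => pa b a))
    (u : ∀ i, U i)
    (f : ∀ i, (∀ j, V j) → U i → V i)
    (hf : ∀ i (v w : ∀ j, V j) (n : U i),
      (∀ j, pa i j → v j = w j) → f i v n = f i w n)
    (X : Fin N) (x : V X)
    (g : ∀ i, (∀ j, V j) → U i → V i)
    (hgX : ∀ (v : ∀ j, V j) (n : U X), g X v n = x)
    (hg : ∀ i, i ≠ X → g i = f i)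
    (v v' : ∀ i, V i)
    (hv : ∀ i, v i = f i v (u i))
    (hv' : ∀ i, v' i = g i v' (u i)) :
    ∀ j, j ≠ X → ¬ Relation.TransGen (fun a b => pa b a) X j → v' j = v j := by
  have hwf : WellFounded (Relation.TransGen fun a b => pa b a) := by
    haveI : Std.Irrefl (Relation.TransGen fun a b => pa b a) := ⟨fun a h => hacyc a h⟩
    haveI : IsTrans (Fin N) (Relation.TransGen fun a b => pa b a) :=
      ⟨fun _ _ _ h1 h2 => Relation.TransGen.trans h1 h2⟩
    exact Finite.wellFounded_of_trans_of_irrefl _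
  intro j
  induction j using hwf.induction with
  | _ j ih =>
    intro hj hd
    rw [hv' j, hv j, hg j hj]
    apply hf
    intro k hk
    refine ih k (Relation.TransGen.single hk) ?_ ?_
    · rintro rfl
      exact hd (Relation.TransGen.single hk)
    · intro h
      exact hd (Relation.TransGen.tail h hk)
end
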